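/- Let (Ω, ℙ) be a probability space, let E be a real normed vector space, let x̄, y ∈ E, let d : Ω → E, and let ρ ≥ 0, s ≥ 0, w ≥ 0, L ≥ 0 and p ∈ [0,1] be real numbers. Let h : E → ℝ satisfy h(x) ≤ h(x̄) + L·‖x − x̄‖ for every x ∈ E with ‖x − x̄‖ ≤ ρ·s + w. Suppose ‖y − x̄‖ ≤ ρ·s, ℙ{ω : ‖d(ω)‖ ≤ w} ≥ p, and h(x̄) + L·(ρ·s + w) ≤ 0. Then ℙ{ω : h(y + d(ω)) ≤ 0} ≥ p. -/

import Mathlib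

open MeasureTheory

theorem stmt_6 (Ω : Type*) [MeasurableSpace Ω] (ℙ : Measure Ω) [IsProbabilityMeasure ℙ]
    (E : Type*) [NormedAddCommGroup E] [NormedSpace ℝ E]
    (xbar y : E) (d : Ω → E) (ρ s w L p : ℝ)
    (hρ : 0 ≤ ρ) (hs : 0 ≤ s) (hw : 0 ≤ w) (hL : 0 ≤ L) (hp0 : 0 ≤ p) (hp1 : p ≤ 1)
    (h : E → ℝ)
    (hLip : ∀ x : E, ‖x - xbar‖ ≤ ρ * s + w → h x ≤ h xbar + L * ‖x - xbar‖)
    (hy : ‖y - xbar‖ ≤ ρ * s)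
    (hd : ENNReal.ofReal p ≤ ℙ {ω | ‖d ω‖ ≤ w})
    (htight : h xbar + L * (ρ * s + w) ≤ 0) :
    ENNReal.ofReal p ≤ ℙ {ω | h (y + d ω) ≤ 0} := by
  refine hd.trans (measure_mono fun ω (hω : ‖d ω‖ ≤ w) => ?_)
  have hball : ‖y + d ω - xbar‖ ≤ ρ * s + w := by
    rw [add_sub_right_comm]
    exact norm_add_le_of_le hy hω
  calc h (y + d ω) ≤ h xbar + L * ‖y + d ω - xbar‖ := hLip _ hball
    _ ≤ h xbar + L * (ρ * s + w) := by gcongr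
    _ ≤ 0 := htight
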